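/- arXiv:1410.8585 — 2 statements merged into one kernel-verified Lean document; each statement's English description precedes it below -/
import Mathlib

section
/- Let n be an even positive integer, let SU(n) be the special unitary group of n × n complex matrices with Haar probability measure μ, and let perm(g) = ∑_{σ ∈ Perm(Fin n)} ∏_i g_{i,σ(i)} denote the permanent. Then ∫_{g ∈ SU(n)} (∏_{1 ≤ i,j ≤ n} g_{ij}) dμ(g) ≠ 0 if and only if ∫_{g ∈ SU(n)} (perm g)^n dμ(g) ≠ 0. -/
open scoped Classical

namespace AlonTarsi

/-- `L` is a Latin square: each row and each column is a bijection of `Fin n`. -/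
def IsLatin {n : ℕ} (L : Fin n → Fin n → Fin n) : Prop :=
  (∀ k, Function.Bijective fun i => L k i) ∧ (∀ i, Function.Bijective fun k => L k i)

/-- The sign of a function `Fin n → Fin n`: the sign of the corresponding permutation
if it is bijective, and `1` otherwise. -/
noncomputable def signFun {n : ℕ} (f : Fin n → Fin n) : ℤ :=
  if h : Function.Bijective f then (Equiv.Perm.sign (Equiv.ofBijective f h) : ℤ) else 1

noncomputable def rowSign {n : ℕ} (L : Fin n → Fin n → Fin n) : ℤ :=
  ∏ k, signFun fun i => L k i

noncomputable def colSign {n : ℕ} (L : Fin n → Fin n → Fin n) : ℤ :=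
  ∏ i, signFun fun k => L k i

noncomputable def sign {n : ℕ} (L : Fin n → Fin n → Fin n) : ℤ :=
  rowSign L * colSign L

noncomputable def evenCard (n : ℕ) : ℕ :=
  (Finset.univ.filter fun L : Fin n → Fin n → Fin n => IsLatin L ∧ sign L = 1).card

noncomputable def oddCard (n : ℕ) : ℕ :=
  (Finset.univ.filter fun L : Fin n → Fin n → Fin n => IsLatin L ∧ sign L = -1).card

noncomputable def colEvenCard (n : ℕ) : ℕ :=
  (Finset.univ.filter fun L : Fin n → Fin n → Fin n => IsLatin L ∧ colSign L = 1).card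

noncomputable def colOddCard (n : ℕ) : ℕ :=
  (Finset.univ.filter fun L : Fin n → Fin n → Fin n => IsLatin L ∧ colSign L = -1).card

noncomputable instance (n : ℕ) : MeasurableSpace (Matrix.specialUnitaryGroup (Fin n) ℂ) :=
  borel _

instance (n : ℕ) : BorelSpace (Matrix.specialUnitaryGroup (Fin n) ℂ) := ⟨rfl⟩

/-- The permanent of an n × n complex matrix. -/
noncomputable def permanent {n : ℕ} (M : Matrix (Fin n) (Fin n) ℂ) : ℂ :=
  ∑ σ : Equiv.Perm (Fin n), ∏ i : Fin n, M i (σ i)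

section Apolar

open MvPolynomial

variable {σ R : Type*} [CommRing R]

/-- The factorial of a multi-index. -/
def multiFactorial (a : σ →₀ ℕ) : ℕ := a.prod fun _ k => k.factorial

lemma multiFactorial_pos (a : σ →₀ ℕ) : 0 < multiFactorial a :=
  Finset.prod_pos fun _ _ => Nat.factorial_pos _

lemma multiFactorial_add_single (a : σ →₀ ℕ) (i : σ) :
    multiFactorial (a + Finsupp.single i 1) = (a i + 1) * multiFactorial a := by
  have h (s : Finset σ) (b : σ →₀ ℕ) (hs : b.support ⊆ s) :
      multiFactorial b = ∏ j ∈ s, (b j).factorial :=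
    Finsupp.prod_of_support_subset _ hs _ fun _ _ => Nat.factorial_zero
  have ha : a.support ⊆ insert i a.support := Finset.subset_insert _ _
  have hi : i ∈ insert i a.support := Finset.mem_insert_self _ _
  rw [h (insert i a.support) a ha, h (insert i a.support) (a + Finsupp.single i 1),
    ← Finset.mul_prod_erase _ _ hi, ← Finset.mul_prod_erase _ _ hi]
  · have : ∀ j ∈ (insert i a.support).erase i,
        ((a + Finsupp.single i 1 : σ →₀ ℕ) j).factorial = (a j).factorial := by
      intro j hj
      simp [Finsupp.single_eq_of_ne (Finset.ne_of_mem_erase hj)]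
    rw [Finset.prod_congr rfl this]
    simp [Nat.factorial_succ, mul_assoc]
  · intro j hj
    by_cases hji : j = i
    · simp [hji]
    · simpa [Finsupp.single_eq_of_ne hji, hji] using hj

/-- The apolar pairing `⟨p, q⟩ = p(∂) q |₀` of polynomials, under which distinct monomials are
orthogonal and a monomial pairs with itself to its multi-index factorial. -/
noncomputable def apolar (R : Type*) [CommRing R] :
    MvPolynomial σ R →ₗ[R] MvPolynomial σ R →ₗ[R] R :=
  (basisMonomials σ R).constr R fun a => (multiFactorial a : R) • lcoeff R a

lemma apolar_monomial (a : σ →₀ ℕ) (r : R) (q : MvPolynomial σ R) :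
    apolar R (monomial a r) q = r * (multiFactorial a * coeff a q) := by
  have h : apolar R (monomial a (1 : R)) = (multiFactorial a : R) • lcoeff R a := by
    simpa [apolar] using (basisMonomials σ R).constr_basis R
      (fun a => (multiFactorial a : R) • lcoeff R a) a
  have h' : monomial a r = r • monomial a (1 : R) := by simp [smul_monomial]
  rw [h', map_smul, h]
  simp

lemma apolar_apply (p q : MvPolynomial σ R) :
    apolar R p q = ∑ a ∈ p.support, coeff a p * (multiFactorial a * coeff a q) := by
  refine (congrArg (apolar R · q) p.as_sum).trans ?_
  simp only [map_sum, LinearMap.sum_apply, apolar_monomial]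

lemma apolar_monomial_right (a : σ →₀ ℕ) (r : R) (p : MvPolynomial σ R) :
    apolar R p (monomial a r) = r * (multiFactorial a * coeff a p) := by
  induction p using MvPolynomial.induction_on' with
  | add p p' hp hp' => simp [mul_add, hp, hp']
  | monomial b s =>
    rw [apolar_monomial, coeff_monomial, coeff_monomial]
    by_cases h : a = b
    · subst h
      simp only [if_true]
      ring
    · simp [h, Ne.symm h]

lemma apolar_mul_X (p q : MvPolynomial σ R) (i : σ) :
    apolar R (p * X i) q = apolar R p (pderiv i q) := by
  induction p using MvPolynomial.induction_on' with
  | add p p' hp hp' => simp [add_mul, hp, hp']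
  | monomial a r =>
    rw [X, monomial_mul, apolar_monomial, apolar_monomial, coeff_pderiv,
      multiFactorial_add_single]
    push_cast
    ring

lemma apolar_map_self_ne_zero (P : MvPolynomial σ ℤ) (hP : P ≠ 0) :
    apolar ℂ (P.map (Int.castRingHom ℂ)) (P.map (Int.castRingHom ℂ)) ≠ 0 := by
  have h : apolar ℂ (P.map (Int.castRingHom ℂ)) (P.map (Int.castRingHom ℂ)) =
      ((∑ a ∈ P.support, coeff a P * (multiFactorial a * coeff a P) : ℤ) : ℂ) := by
    rw [apolar_apply, support_map_of_injective _ (RingHom.injective_int _)]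
    simp [coeff_map]
  rw [h, Int.cast_ne_zero]
  refine (Finset.sum_pos (fun a ha => ?_) (support_nonempty.mpr hP)).ne'
  have := multiFactorial_pos a
  have h2 := mul_self_pos.mpr (mem_support_iff.mp ha)
  rw [mul_left_comm]
  positivity

variable [Fintype σ]

/-- Linear substitution `X i ↦ ∑ j, L i j * X j`. -/
noncomputable def linSubst (L : Matrix σ σ R) : MvPolynomial σ R →ₐ[R] MvPolynomial σ R :=
  aeval fun i => ∑ j, L i j • X j

@[simp]
lemma linSubst_X (L : Matrix σ σ R) (i : σ) : linSubst L (X i) = ∑ j, L i j • X j :=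
  aeval_X _ _

lemma coeff_zero_linSubst (L : Matrix σ σ R) (p : MvPolynomial σ R) :
    coeff 0 (linSubst L p) = coeff 0 p := by
  induction p using MvPolynomial.induction_on with
  | C r => simp [linSubst]
  | add p q hp hq => simp [hp, hq]
  | mul_X p i _ =>
    simp only [← constantCoeff_eq, map_mul, linSubst_X, constantCoeff_X, mul_zero]
    simp

lemma pderiv_linSubst (L : Matrix σ σ R) (j : σ) (p : MvPolynomial σ R) :
    pderiv j (linSubst L p) = ∑ i, L i j • linSubst L (pderiv i p) := by
  induction p using MvPolynomial.induction_on with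
  | C r => simp [linSubst]
  | add p q hp hq => simp [hp, hq, Finset.sum_add_distrib]
  | mul_X p k hp =>
    simp only [map_mul, Derivation.leibniz, hp, linSubst_X, map_sum, Derivation.map_smul, pderiv_X,
      smul_eq_mul, map_add, smul_add, Finset.sum_add_distrib]
    congr 1
    · simp [Pi.single_apply, smul_eq_C_mul, mul_comm]
    · simp [Finset.mul_sum]

/-- Linear substitutions by a matrix and by its transpose are adjoint for the apolar pairing. -/
lemma apolar_linSubst (L : Matrix σ σ R) (p q : MvPolynomial σ R) :
    apolar R (linSubst L p) q = apolar R p (linSubst L.transpose q) := by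
  induction p using MvPolynomial.induction_on generalizing q with
  | C r =>
    have : linSubst L (C r) = C r := by simp [linSubst]
    rw [this, ← monomial_zero', apolar_monomial, apolar_monomial, coeff_zero_linSubst]
  | add p p' hp hp' => simp [hp, hp']
  | mul_X p i hp =>
    simp [Finset.mul_sum, apolar_mul_X, pderiv_linSubst, hp]

end Apolar

section GenericTranslate

open MvPolynomial Matrix

variable {n : ℕ} {R : Type*} [CommRing R]

/-- The product of all entries of `X * g`, where `X` is the generic `n × n` matrix. -/
noncomputable def prodEntriesMul (g : Matrix (Fin n) (Fin n) R) :
    MvPolynomial (Fin n × Fin n) R :=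
  ∏ i, ∏ k, ∑ j, C (g j k) * X (i, j)

lemma map_prodEntriesMul {S : Type*} [CommRing S] (φ : R →+* S) (g : Matrix (Fin n) (Fin n) R) :
    (prodEntriesMul g).map φ = prodEntriesMul (g.map φ) := by
  simp [prodEntriesMul]

lemma eval_prodEntriesMul (T g : Matrix (Fin n) (Fin n) R) :
    eval (fun a => T a.1 a.2) (prodEntriesMul g) = ∏ i, ∏ k, (T * g) i k := by
  simp [prodEntriesMul, Matrix.mul_apply, mul_comm]

/-- The multi-index of the product of all the variables. -/
noncomputable def onesIndex (n : ℕ) : Fin n × Fin n →₀ ℕ :=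
  Finsupp.equivFunOnFinite.symm fun _ => 1

lemma multiFactorial_onesIndex : multiFactorial (onesIndex n) = 1 :=
  Finset.prod_eq_one fun _ _ => by simp [onesIndex]

lemma sum_single_eq_onesIndex_iff (φ : Fin n → Fin n → Fin n) :
    (∑ i, ∑ k, Finsupp.single (i, φ i k) 1) = onesIndex n ↔ ∀ i, Function.Bijective (φ i) := by
  have key (i j : Fin n) : (∑ i, ∑ k, Finsupp.single (i, φ i k) 1 : Fin n × Fin n →₀ ℕ) (i, j) =
      (Finset.univ.filter fun k => φ i k = j).card := by
    simp only [Finsupp.coe_finsetSum, Finset.sum_apply, Finsupp.single_apply, Prod.mk.injEq,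
      Finset.card_filter, ite_and]
    rw [Finset.sum_eq_single i] <;> simp +contextual
  rw [DFunLike.ext_iff, Prod.forall]
  simp only [key, onesIndex, Finsupp.equivFunOnFinite_symm_apply_apply, Finset.card_eq_one]
  refine forall_congr' fun i => ?_
  rw [Function.bijective_iff_existsUnique]
  refine forall_congr' fun j => ?_
  simp only [Finset.ext_iff, Finset.mem_filter, Finset.mem_univ, true_and, Finset.mem_singleton,
    ExistsUnique]
  exact exists_congr fun k => ⟨fun h => ⟨(h k).mpr rfl, fun l => (h l).mp⟩,
    fun h l => ⟨h.2 l, fun hl => hl ▸ h.1⟩⟩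

lemma sum_bijective_prod (g : Matrix (Fin n) (Fin n) ℂ) :
    (∑ ψ : Fin n → Fin n, if Function.Bijective ψ then ∏ k, g (ψ k) k else 0) = permanent g := by
  rw [permanent, ← Finset.sum_filter]
  have hinj : Function.Injective fun (σ : Equiv.Perm (Fin n)) => (⇑σ⁻¹ : Fin n → Fin n) :=
    DFunLike.coe_injective.comp inv_injective
  symm
  refine Finset.sum_of_injOn _ hinj.injOn (fun σ _ => ?_) (fun ψ hψ hψ' => ?_) (fun σ _ => ?_)
  · exact Finset.mem_coe.mpr (Finset.mem_filter.mpr ⟨Finset.mem_univ _, σ⁻¹.bijective⟩)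
  · rw [Finset.mem_filter] at hψ
    refine absurd ⟨(Equiv.ofBijective ψ hψ.2)⁻¹, by simp, ?_⟩ hψ'
    simp only [inv_inv]
    rfl
  · rw [← Equiv.prod_comp σ fun k => g (σ⁻¹ k) k]
    simp

lemma coeff_onesIndex_prodEntriesMul (g : Matrix (Fin n) (Fin n) ℂ) :
    coeff (onesIndex n) (prodEntriesMul g) = permanent g ^ n := by
  have h : prodEntriesMul g = ∑ φ : Fin n → Fin n → Fin n,
      monomial (∑ i, ∑ k, Finsupp.single (i, φ i k) 1) (∏ i, ∏ k, g (φ i k) k) := by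
    simp only [prodEntriesMul, Finset.prod_univ_sum, Fintype.piFinset_univ, C_mul_X_eq_monomial,
      monomial_sum_prod]
  have h2 (φ : Fin n → Fin n → Fin n) : (if ∀ i, Function.Bijective (φ i) then
      ∏ i, ∏ k, g (φ i k) k else 0) =
      ∏ i, if Function.Bijective (φ i) then ∏ k, g (φ i k) k else 0 := by
    split_ifs with hφ
    · exact Finset.prod_congr rfl fun i _ => (if_pos (hφ i)).symm
    · push Not at hφ
      obtain ⟨i, hi⟩ := hφ
      exact (Finset.prod_eq_zero (Finset.mem_univ i) (if_neg hi)).symm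
  rw [h, coeff_sum]
  simp only [coeff_monomial, sum_single_eq_onesIndex_iff, h2]
  have h3 := Finset.prod_univ_sum (fun _ : Fin n => (Finset.univ : Finset (Fin n → Fin n)))
    (fun _ ψ => if Function.Bijective ψ then ∏ k, g (ψ k) k else 0)
  rw [Fintype.piFinset_univ] at h3
  rw [← h3, sum_bijective_prod, Finset.prod_const, Finset.card_univ, Fintype.card_fin]

lemma prod_X_eq_monomial :
    (∏ i, ∏ k, X (i, k) : MvPolynomial (Fin n × Fin n) R) = monomial (onesIndex n) 1 := by
  have h := (sum_single_eq_onesIndex_iff (n := n) fun _ k => k).mpr fun _ => Function.bijective_id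
  rw [← h]
  simp [monomial_sum_one, X]

/-- Pairing with a power of the determinant is invariant under `SL n`. -/
lemma apolar_det_pow_prodEntriesMul (m : ℕ) (g : Matrix (Fin n) (Fin n) R) (hg : g.det = 1) :
    apolar R ((mvPolynomialX (Fin n) (Fin n) R).det ^ m) (prodEntriesMul g) =
      coeff (onesIndex n) ((mvPolynomialX (Fin n) (Fin n) R).det ^ m) := by
  let L : Matrix (Fin n × Fin n) (Fin n × Fin n) R :=
    Matrix.of fun a b => if a.1 = b.1 then g b.2 a.2 else 0
  have hL : prodEntriesMul g = linSubst L (∏ i, ∏ k, X (i, k)) := by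
    simp [prodEntriesMul, L, Fintype.sum_prod_type, smul_eq_C_mul]
  have hdet : linSubst Lᵀ (mvPolynomialX (Fin n) (Fin n) R).det =
      (mvPolynomialX (Fin n) (Fin n) R).det := by
    have : (linSubst Lᵀ).mapMatrix (mvPolynomialX (Fin n) (Fin n) R) =
        mvPolynomialX (Fin n) (Fin n) R * (g.map C)ᵀ := by
      ext1 i j
      simp [L, Matrix.mul_apply, Fintype.sum_prod_type, smul_eq_C_mul, mul_comm]
    rw [AlgHom.map_det, this, det_mul, det_transpose]
    have h := (RingHom.map_det (C : R →+* MvPolynomial (Fin n × Fin n) R) g).symm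
    rw [hg, map_one] at h
    rw [← RingHom.mapMatrix_apply, h, mul_one]
  have hadj := apolar_linSubst Lᵀ ((mvPolynomialX (Fin n) (Fin n) R).det ^ m) (∏ i, ∏ k, X (i, k))
  rw [transpose_transpose, ← hL, map_pow, hdet] at hadj
  rw [← hadj, prod_X_eq_monomial, apolar_monomial_right, multiFactorial_onesIndex]
  simp

end GenericTranslate

section Unitary

open MvPolynomial Matrix
open scoped ComplexOrder

lemma infinite_unit_circle : {z : ℂ | ‖z‖ = 1}.Infinite := by
  have h : {z : ℂ | ‖z‖ = 1} = Metric.sphere 0 1 := by ext; simp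
  rw [h]
  exact (isPreconnected_sphere (by simp [Complex.rank_real_complex]) 0 1).infinite_of_nontrivial
    ⟨1, by simp, -1, by simp, by norm_num⟩

/-- Polar-type factorization of an invertible matrix. -/
lemma exists_unitary_diagonal_unitary {n : Type*} [Fintype n] [DecidableEq n]
    (T : Matrix n n ℂ)
    (hT : IsUnit T.det) :
    ∃ u ∈ unitaryGroup n ℂ, ∃ d : n → ℂ, ∃ v ∈ unitaryGroup n ℂ, T = u * diagonal d * v := by
  have hpd : (T * Tᴴ).PosDef :=
    PosDef.mul_conjTranspose_self T (vecMul_injective_of_isUnit ((isUnit_iff_isUnit_det T).mpr hT))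
  have hH := hpd.isHermitian
  let u : Matrix n n ℂ := hH.eigenvectorUnitary
  let d : n → ℂ := fun i => (Real.sqrt (hH.eigenvalues i) : ℂ)
  have hd (i : n) : d i ≠ 0 := by
    have := hpd.eigenvalues_pos i
    simp only [d, ne_eq, Complex.ofReal_eq_zero]
    positivity
  have hdd (i : n) : d i * d i = hH.eigenvalues i := by
    rw [← Complex.ofReal_mul, Real.mul_self_sqrt (hpd.eigenvalues_pos i).le]
  have hu : u ∈ unitaryGroup n ℂ := hH.eigenvectorUnitary.2
  have huu : uᴴ * u = 1 := mem_unitaryGroup_iff'.mp hu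
  have huu' : u * uᴴ = 1 := mem_unitaryGroup_iff.mp hu
  have hspec : T * Tᴴ = u * diagonal (fun i => d i * d i) * uᴴ := by
    simp only [hdd]
    exact hH.spectral_theorem
  have hinv : diagonal d * diagonal (fun i => (d i)⁻¹) = 1 := by
    simp [hd]
  have hstar : (diagonal fun i => (d i)⁻¹)ᴴ = diagonal fun i => (d i)⁻¹ := by
    simp only [diagonal_conjTranspose]
    congr 1
    ext i
    simp [d]
  refine ⟨u, hu, d, diagonal (fun i => (d i)⁻¹) * uᴴ * T, ?_, ?_⟩
  · rw [mem_unitaryGroup_iff, star_eq_conjTranspose, conjTranspose_mul, conjTranspose_mul,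
      hstar, conjTranspose_conjTranspose]
    calc diagonal (fun i => (d i)⁻¹) * uᴴ * T * (Tᴴ * (u * diagonal fun i => (d i)⁻¹))
        = diagonal (fun i => (d i)⁻¹) * uᴴ * (T * Tᴴ) * u * diagonal fun i => (d i)⁻¹ := by
          simp only [Matrix.mul_assoc]
      _ = diagonal (fun i => (d i)⁻¹) * (uᴴ * u) * diagonal (fun i => d i * d i) * (uᴴ * u) *
            diagonal fun i => (d i)⁻¹ := by
          rw [hspec]; simp only [Matrix.mul_assoc]
      _ = 1 := by
          simp [huu, hd]
  · calc T = u * (diagonal d * diagonal fun i => (d i)⁻¹) * uᴴ * T := by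
          rw [hinv, Matrix.mul_one, huu', Matrix.one_mul]
      _ = _ := by simp only [Matrix.mul_assoc]

variable {n : ℕ}

/-- A homogeneous polynomial of degree `n * m` on `n × n` matrices that is invariant under right
multiplication by `SU(n)` is a multiple of `det ^ m`. -/
lemma eq_C_mul_det_pow (hn : 0 < n) (m : ℕ) (Q : MvPolynomial (Fin n × Fin n) ℂ)
    (hhom : ∀ (z : ℂ) (T : Matrix (Fin n) (Fin n) ℂ),
      eval (fun a => (z • T) a.1 a.2) Q = z ^ (n * m) * eval (fun a => T a.1 a.2) Q)
    (hinv : ∀ T : Matrix (Fin n) (Fin n) ℂ, ∀ u ∈ specialUnitaryGroup (Fin n) ℂ,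
      eval (fun a => (T * u) a.1 a.2) Q = eval (fun a => T a.1 a.2) Q) :
    Q = C (eval (fun a => (1 : Matrix (Fin n) (Fin n) ℂ) a.1 a.2) Q) *
      (mvPolynomialX (Fin n) (Fin n) ℂ).det ^ m := by
  obtain ⟨h, hh⟩ : ∃ h : Matrix (Fin n) (Fin n) ℂ → ℂ, ∀ T, h T = eval (fun a => T a.1 a.2) Q :=
    ⟨_, fun _ => rfl⟩
  simp only [← hh] at hhom hinv ⊢
  have hU (T u : Matrix (Fin n) (Fin n) ℂ) (hu : u ∈ unitaryGroup (Fin n) ℂ) :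
      h (T * u) = u.det ^ m * h T := by
    obtain ⟨z, hz⟩ := IsAlgClosed.exists_pow_nat_eq u.det hn
    have hdet : ‖u.det‖ = 1 :=
      CStarRing.norm_of_mem_unitary (det_of_mem_unitary hu)
    have hz1 : ‖z‖ = 1 := by
      rw [← pow_eq_one_iff_of_nonneg (norm_nonneg z) hn.ne', ← norm_pow, hz, hdet]
    have hz0 : z ≠ 0 := by rintro rfl; simp at hz1
    have hmem : z⁻¹ • u ∈ specialUnitaryGroup (Fin n) ℂ := by
      rw [mem_specialUnitaryGroup_iff]
      constructor
      · rw [mem_unitaryGroup_iff] at hu ⊢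
        rw [star_smul, Matrix.smul_mul, Matrix.mul_smul, smul_smul, hu]
        have : z⁻¹ * star z⁻¹ = 1 := by
          rw [Complex.star_def, Complex.mul_conj, Complex.normSq_eq_norm_sq, norm_inv, hz1]
          simp
        rw [this, one_smul]
      · rw [det_smul, Fintype.card_fin, inv_pow, hz, inv_mul_cancel₀]
        rintro h0
        simp [h0] at hdet
    have h1 : T * u = z • (T * (z⁻¹ • u)) := by
      rw [Matrix.mul_smul, smul_smul, mul_inv_cancel₀ hz0, one_smul]
    calc h (T * u) = z ^ (n * m) * h (T * (z⁻¹ • u)) := by rw [h1]; exact hhom _ _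
      _ = u.det ^ m * h T := by rw [pow_mul, hz]; congr 1; exact hinv _ _ hmem
  have hD (u : Matrix (Fin n) (Fin n) ℂ) (d : Fin n → ℂ) :
      h (u * diagonal d) = (∏ i, d i) ^ m * h u := by
    have hev (s : Fin n → ℂ) :
        eval s (bind₁ (fun a : Fin n × Fin n => C (u a.1 a.2) * X a.2) Q)
          = h (u * diagonal s) := by
      rw [hh]
      refine (eval₂Hom_bind₁ (RingHom.id ℂ) s _ Q).trans ?_
      simp only [mul_diagonal]
      congr 2
      ext a
      simp
    have hpoly : bind₁ (fun a : Fin n × Fin n => C (u a.1 a.2) * X a.2) Q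
        = (∏ i, X i) ^ m * C (h u) := by
      refine funext_set (fun _ => {z : ℂ | ‖z‖ = 1}) (fun _ => infinite_unit_circle) fun s hs => ?_
      rw [hev, hU]
      · simp
      · rw [mem_unitaryGroup_iff, star_eq_conjTranspose, diagonal_conjTranspose,
          diagonal_mul_diagonal, ← diagonal_one]
        congr 1
        ext i
        have : ‖s i‖ = 1 := hs i trivial
        simp [Complex.mul_conj, Complex.normSq_eq_norm_sq, this]
    rw [← hev, hpoly]
    simp
  have hinvertible (T : Matrix (Fin n) (Fin n) ℂ) (hT : IsUnit T.det) :
      h T = h 1 * T.det ^ m := by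
    obtain ⟨u, hu, d, v, hv, rfl⟩ := exists_unitary_diagonal_unitary T hT
    have h1 := hU 1 u hu
    rw [Matrix.one_mul] at h1
    rw [hU _ v hv, hD, h1, det_mul, det_mul, det_diagonal]
    ring
  refine mul_left_cancel₀ (det_mvPolynomialX_ne_zero (Fin n) ℂ) ?_
  refine MvPolynomial.funext fun s => ?_
  rw [map_mul, map_mul, map_mul, map_pow, eval_C, eval_det_mvPolynomialX]
  by_cases hs : IsUnit (Matrix.of fun i j => s (i, j)).det
  · congr 1
    have h1 := hinvertible _ hs
    rw [hh] at h1
    exact h1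
  · rw [isUnit_iff_ne_zero, not_not] at hs
    rw [hs, zero_mul, zero_mul]

end Unitary

section Haar

open MvPolynomial Matrix MeasureTheory

variable {n : ℕ} (μ : Measure (specialUnitaryGroup (Fin n) ℂ))

lemma integrable_eval [IsProbabilityMeasure μ] (p : MvPolynomial (Fin n × Fin n) ℂ) :
    Integrable (fun g : specialUnitaryGroup (Fin n) ℂ =>
      eval (fun a => (g : Matrix (Fin n) (Fin n) ℂ) a.1 a.2) p) μ := by
  have hcont : Continuous fun g : specialUnitaryGroup (Fin n) ℂ =>
      eval (fun a => (g : Matrix (Fin n) (Fin n) ℂ) a.1 a.2) p :=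
    (continuous_eval p).comp <| continuous_pi fun a =>
      continuous_subtype_val.matrix_elem a.1 a.2
  have hbdd : ∃ K : ℝ, ∀ g : specialUnitaryGroup (Fin n) ℂ,
      ‖eval (fun a => (g : Matrix (Fin n) (Fin n) ℂ) a.1 a.2) p‖ ≤ K := by
    refine ⟨∑ a ∈ p.support, ‖coeff a p‖, fun g => ?_⟩
    rw [eval_eq]
    refine (norm_sum_le _ _).trans (Finset.sum_le_sum fun a _ => ?_)
    rw [norm_mul, norm_prod]
    refine mul_le_of_le_one_right (norm_nonneg _) (Finset.prod_le_one (fun _ _ => norm_nonneg _) ?_)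
    intro i _
    rw [norm_pow]
    exact pow_le_one₀ (norm_nonneg _) (entry_norm_bound_of_unitary g.2.1 _ _)
  obtain ⟨K, hK⟩ := hbdd
  exact Integrable.of_bound hcont.aestronglyMeasurable K (Filter.Eventually.of_forall hK)

/-- The coefficients of `prodEntriesMul g` are polynomials in the entries of `g`. -/
lemma coeff_prodEntriesMul_eq_eval (g : Matrix (Fin n) (Fin n) ℂ) (a : Fin n × Fin n →₀ ℕ) :
    coeff a (prodEntriesMul g) = eval (fun b => g b.1 b.2)
      (coeff a (prodEntriesMul (mvPolynomialX (Fin n) (Fin n) ℂ))) := by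
  rw [← coeff_map, map_prodEntriesMul]
  congr 2
  ext i j
  simp

lemma integrable_coeff_prodEntriesMul [IsProbabilityMeasure μ] (a : Fin n × Fin n →₀ ℕ) :
    Integrable (fun g : specialUnitaryGroup (Fin n) ℂ =>
      coeff a (prodEntriesMul (g : Matrix (Fin n) (Fin n) ℂ))) μ := by
  simp only [coeff_prodEntriesMul_eq_eval]
  exact integrable_eval μ _

/-- The averages of the coefficients of `prodEntriesMul g` are those of a multiple of `det ^ n`. -/
lemma integral_coeff_prodEntriesMul (hn : 0 < n) [IsProbabilityMeasure μ] [μ.IsMulLeftInvariant]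
    (a : Fin n × Fin n →₀ ℕ) :
    ∫ g : specialUnitaryGroup (Fin n) ℂ,
        coeff a (prodEntriesMul (g : Matrix (Fin n) (Fin n) ℂ)) ∂μ =
      (∫ g : specialUnitaryGroup (Fin n) ℂ,
        (∏ i, ∏ j, (g : Matrix (Fin n) (Fin n) ℂ) i j) ∂μ) *
      coeff a ((mvPolynomialX (Fin n) (Fin n) ℂ).det ^ n) := by
  let S := (prodEntriesMul (mvPolynomialX (Fin n) (Fin n) ℂ)).support
  let I : (Fin n × Fin n →₀ ℕ) → ℂ := fun a => ∫ g : specialUnitaryGroup (Fin n) ℂ,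
    coeff a (prodEntriesMul (g : Matrix (Fin n) (Fin n) ℂ)) ∂μ
  let Q : MvPolynomial (Fin n × Fin n) ℂ := ∑ a ∈ S, monomial a (I a)
  have hsupp (g : Matrix (Fin n) (Fin n) ℂ) (a) (ha : a ∉ S) :
      coeff a (prodEntriesMul g) = 0 := by
    rw [coeff_prodEntriesMul_eq_eval, notMem_support_iff.mp ha, map_zero]
  have hcoeff : coeff a Q = I a := by
    simp only [Q, coeff_sum, coeff_monomial, Finset.sum_ite_eq']
    split_ifs with ha
    · rfl
    · simp [I, hsupp _ a ha]
  have heval (T : Matrix (Fin n) (Fin n) ℂ) : eval (fun a => T a.1 a.2) Q =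
      ∫ g : specialUnitaryGroup (Fin n) ℂ,
        (∏ i, ∏ k, (T * (g : Matrix (Fin n) (Fin n) ℂ)) i k) ∂μ := by
    have hsum (g : Matrix (Fin n) (Fin n) ℂ) : ∏ i, ∏ k, (T * g) i k =
        ∑ a ∈ S, coeff a (prodEntriesMul g) * a.prod fun i e => T i.1 i.2 ^ e := by
      rw [← eval_prodEntriesMul]
      have : prodEntriesMul g = ∑ a ∈ S, monomial a (coeff a (prodEntriesMul g)) := by
        conv_lhs => rw [(prodEntriesMul g).as_sum]
        refine Finset.sum_subset (fun a ha => ?_) fun a _ ha => ?_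
        · by_contra h
          exact mem_support_iff.mp ha (hsupp g a h)
        · rw [notMem_support_iff.mp ha, monomial_zero]
      conv_lhs => rw [this]
      simp [eval_monomial]
    simp only [hsum]
    rw [integral_finsetSum _ fun a _ => (integrable_coeff_prodEntriesMul μ a).mul_const _]
    simp [Q, I, eval_monomial, integral_mul_const]
  have hQ : Q = C (eval (fun a => (1 : Matrix (Fin n) (Fin n) ℂ) a.1 a.2) Q) *
      (mvPolynomialX (Fin n) (Fin n) ℂ).det ^ n := by
    refine eq_C_mul_det_pow hn n Q (fun z T => ?_) fun T u hu => ?_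
    · rw [heval, heval, ← integral_const_mul]
      simp [Finset.prod_mul_distrib, pow_mul]
    · rw [heval, heval, ← integral_mul_left_eq_self (fun g : specialUnitaryGroup (Fin n) ℂ =>
        ∏ i, ∏ k, (T * (g : Matrix (Fin n) (Fin n) ℂ)) i k) ⟨u, hu⟩]
      simp [Matrix.mul_assoc]
  change I a = _
  rw [← hcoeff, hQ, coeff_C_mul, heval]
  simp

/-- Contracting against `det ^ n` shows that the integral of the product of the entries is, up to
a nonzero factor, the coefficient of the product of all the variables in `det ^ n`. -/
lemma integral_prod_entries_mul_apolar (hn : 0 < n) [IsProbabilityMeasure μ]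
    [μ.IsMulLeftInvariant] :
    (∫ g : specialUnitaryGroup (Fin n) ℂ,
        (∏ i, ∏ j, (g : Matrix (Fin n) (Fin n) ℂ) i j) ∂μ) *
      apolar ℂ ((mvPolynomialX (Fin n) (Fin n) ℂ).det ^ n)
        ((mvPolynomialX (Fin n) (Fin n) ℂ).det ^ n) =
      coeff (onesIndex n) ((mvPolynomialX (Fin n) (Fin n) ℂ).det ^ n) := by
  set D := (mvPolynomialX (Fin n) (Fin n) ℂ).det ^ n with hD
  have h1 : ∫ g : specialUnitaryGroup (Fin n) ℂ,
      apolar ℂ D (prodEntriesMul (g : Matrix (Fin n) (Fin n) ℂ)) ∂μ = coeff (onesIndex n) D := by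
    have (g : specialUnitaryGroup (Fin n) ℂ) :
        apolar ℂ D (prodEntriesMul (g : Matrix (Fin n) (Fin n) ℂ)) = coeff (onesIndex n) D :=
      apolar_det_pow_prodEntriesMul n _ g.2.2
    simp [this]
  rw [← h1]
  simp only [apolar_apply]
  rw [integral_finsetSum _ fun a _ => ((integrable_coeff_prodEntriesMul μ a).const_mul _).const_mul _, Finset.mul_sum]
  refine Finset.sum_congr rfl fun a _ => ?_
  rw [integral_const_mul, integral_const_mul, integral_coeff_prodEntriesMul μ hn, ← hD]
  ring

lemma apolar_det_pow_self_ne_zero (n m : ℕ) :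
    apolar ℂ ((mvPolynomialX (Fin n) (Fin n) ℂ).det ^ m)
      ((mvPolynomialX (Fin n) (Fin n) ℂ).det ^ m) ≠ 0 := by
  have h : ((mvPolynomialX (Fin n) (Fin n) ℤ).det ^ m).map (Int.castRingHom ℂ) =
      (mvPolynomialX (Fin n) (Fin n) ℂ).det ^ m := by
    rw [map_pow, RingHom.map_det]
    congr 2
    ext1 i j
    simp
  rw [← h]
  exact apolar_map_self_ne_zero _ (pow_ne_zero _ (det_mvPolynomialX_ne_zero _ _))

end Haar

open MeasureTheory in
/-- For n even, the integral over SU(n) of the product of all matrix entries is nonzero iff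
the integral over SU(n) of the n-th power of the permanent is nonzero (Haar probability
measure). -/
theorem integral_prod_entries_ne_zero_iff_integral_permanent_pow_ne_zero
    (n : ℕ) (hn : 0 < n) (hev : Even n)
    (μ : Measure (Matrix.specialUnitaryGroup (Fin n) ℂ))
    [IsProbabilityMeasure μ] [μ.IsMulLeftInvariant] :
    (∫ g : Matrix.specialUnitaryGroup (Fin n) ℂ,
        (∏ i : Fin n, ∏ j : Fin n, (g : Matrix (Fin n) (Fin n) ℂ) i j) ∂μ) ≠ 0 ↔
      (∫ g : Matrix.specialUnitaryGroup (Fin n) ℂ,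
        (permanent (g : Matrix (Fin n) (Fin n) ℂ)) ^ n ∂μ) ≠ 0 := by
  have hperm := integral_coeff_prodEntriesMul μ hn (onesIndex n)
  simp only [coeff_onesIndex_prodEntriesMul] at hperm
  rw [hperm, ← integral_prod_entries_mul_apolar μ hn, ← mul_assoc]
  simp [apolar_det_pow_self_ne_zero]

end AlonTarsi
end

section
/- Let n be an even positive integer. In the polynomial ring R = MvPolynomial (Fin n × Fin n) ℂ, let det X = ∑_{σ ∈ Perm(Fin n)} sgn(σ) ∏_i X_{i,σ(i)} and let D : R → R be the linear operator D = ∑_{σ ∈ Perm(Fin n)} ∏_{i} ∂/∂X_{i,σ(i)} (the permanent of the matrix of partial derivative operators, where the product is composition of the commuting partial derivatives). Then the number of even Latin squares of size n differs from the number of odd Latin squares of size n (the Alon–Tarsi property for n) if and only if D^n((det X)^n) ≠ 0. -/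
open scoped Classical

namespace AlonTarsi

/-- The determinant of the generic n × n matrix of variables X_{ij}, over ℂ. -/
noncomputable def genericDetC (n : ℕ) : MvPolynomial (Fin n × Fin n) ℂ :=
  Matrix.det (Matrix.of fun i j : Fin n => (MvPolynomial.X (i, j) : MvPolynomial (Fin n × Fin n) ℂ))

/-- The differential operator D = ∑_{σ ∈ Perm(Fin n)} ∏_i ∂/∂X_{i,σ(i)}: the permanent of
the matrix of partial derivative operators (the partial derivatives commute, so the order
of composition within each product is immaterial). -/
noncomputable def permDerivOp (n : ℕ) : Module.End ℂ (MvPolynomial (Fin n × Fin n) ℂ) :=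
  ∑ σ : Equiv.Perm (Fin n),
    (List.ofFn fun i : Fin n =>
      ((MvPolynomial.pderiv (i, σ i)).toLinearMap :
        Module.End ℂ (MvPolynomial (Fin n × Fin n) ℂ))).prod

open MvPolynomial

/-- The conjugate of `L` obtained by cyclically permuting (row, column, symbol). -/
noncomputable def conjugate {n : ℕ} (L : Fin n → Fin n → Fin n) : Fin n → Fin n → Fin n :=
  fun s k => haveI : Nonempty (Fin n) := ⟨k⟩; Function.invFun (L k) s

theorem rowSign_eq_prod_sign {n : ℕ} {L : Fin n → Fin n → Fin n}
    (hL : ∀ k, Function.Bijective (L k)) :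
    rowSign L = ((∏ k, Equiv.Perm.sign (Equiv.ofBijective (L k) (hL k)) : ℤˣ) : ℤ) := by
  rw [Units.coe_prod]
  exact Finset.prod_congr rfl fun k _ => dif_pos (hL k)

theorem signFun_perm {n : ℕ} (σ : Equiv.Perm (Fin n)) : signFun σ = Equiv.Perm.sign σ := by
  rw [signFun, dif_pos σ.bijective, Equiv.ofBijective_coe]

namespace IsLatin

variable {n : ℕ} {L : Fin n → Fin n → Fin n}

theorem conjugate_eq_iff (hL : IsLatin L) {k i s : Fin n} : conjugate L s k = i ↔ L k i = s := by
  have : Nonempty (Fin n) := ⟨k⟩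
  constructor
  · rintro rfl
    exact Function.rightInverse_invFun (hL.1 k).2 s
  · rintro rfl
    exact Function.leftInverse_invFun (hL.1 k).1 i

theorem conjugate (hL : IsLatin L) : IsLatin (conjugate L) := by
  refine ⟨fun s => Function.Injective.bijective_of_finite fun k k' h => ?_,
    fun k => Function.Injective.bijective_of_finite fun s s' h => ?_⟩
  · have h₁ := hL.conjugate_eq_iff.1 h
    exact (hL.2 _).1 (h₁.trans (hL.conjugate_eq_iff.1 rfl).symm)
  · exact (hL.conjugate_eq_iff.1 h).symm.trans (hL.conjugate_eq_iff.1 rfl)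

theorem conjugate_conjugate_conjugate (hL : IsLatin L) :
    AlonTarsi.conjugate (AlonTarsi.conjugate (AlonTarsi.conjugate L)) = L := by
  funext k i
  rw [hL.conjugate.conjugate.conjugate_eq_iff, hL.conjugate.conjugate_eq_iff,
    hL.conjugate_eq_iff]

theorem rowSign_mul_rowSign_conjugate_mul_colSign (hL : IsLatin L) :
    rowSign L * rowSign (AlonTarsi.conjugate L) * colSign L =
      Equiv.Perm.sign (Equiv.prodComm (Fin n) (Fin n)) := by
  let ρ k := Equiv.ofBijective _ (hL.1 k)
  let δ s := Equiv.ofBijective _ (hL.conjugate.1 s)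
  let γ i := Equiv.ofBijective _ (hL.2 i)
  let W : Equiv.Perm (Fin n × Fin n) := Equiv.prodComm (Fin n) (Fin n)
  have h : Equiv.prodCongrRight δ * W * Equiv.prodCongrRight ρ =
      W * Equiv.prodCongrRight γ * W := by
    ext1 ⟨k, i⟩
    exact Prod.ext rfl (hL.conjugate_eq_iff.2 rfl)
  have hs := congrArg Equiv.Perm.sign h
  simp only [Equiv.Perm.sign_mul, Equiv.Perm.sign_prodCongrRight] at hs
  have hrow : rowSign L = ((∏ k, Equiv.Perm.sign (ρ k) : ℤˣ) : ℤ) :=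
    rowSign_eq_prod_sign hL.1
  have hsym : rowSign (AlonTarsi.conjugate L) = ((∏ k, Equiv.Perm.sign (δ k) : ℤˣ) : ℤ) :=
    rowSign_eq_prod_sign hL.conjugate.1
  have hcol : colSign L = ((∏ k, Equiv.Perm.sign (γ k) : ℤˣ) : ℤ) :=
    rowSign_eq_prod_sign hL.2
  rw [hrow, hsym, hcol, ← Units.val_mul, ← Units.val_mul, Units.val_inj]
  change _ = Equiv.Perm.sign W
  generalize Equiv.Perm.sign W = w at *
  generalize (∏ k, Equiv.Perm.sign (δ k)) = d at *
  generalize (∏ k, Equiv.Perm.sign (ρ k)) = r at *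
  generalize (∏ k, Equiv.Perm.sign (γ k)) = c at *
  rcases Int.units_eq_one_or w with rfl | rfl <;> rcases Int.units_eq_one_or d with rfl | rfl <;>
    rcases Int.units_eq_one_or r with rfl | rfl <;> rcases Int.units_eq_one_or c with rfl | rfl <;>
    simp_all

end IsLatin

theorem signFun_mul_self {n : ℕ} (f : Fin n → Fin n) : signFun f * signFun f = 1 := by
  unfold signFun
  split_ifs
  · rw [← Units.val_mul, Int.units_mul_self, Units.val_one]
  · rfl

theorem rowSign_mul_self {n : ℕ} (L : Fin n → Fin n → Fin n) : rowSign L * rowSign L = 1 := by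
  simp [rowSign, ← Finset.prod_mul_distrib, signFun_mul_self]

theorem colSign_mul_self {n : ℕ} (L : Fin n → Fin n → Fin n) : colSign L * colSign L = 1 := by
  simp [colSign, ← Finset.prod_mul_distrib, signFun_mul_self]

theorem IsLatin.sign_eq {n : ℕ} {L : Fin n → Fin n → Fin n} (hL : IsLatin L) :
    sign L = Equiv.Perm.sign (Equiv.prodComm (Fin n) (Fin n)) * rowSign (AlonTarsi.conjugate L) := by
  rw [← hL.rowSign_mul_rowSign_conjugate_mul_colSign, sign]
  linear_combination (-(rowSign L * colSign L)) * rowSign_mul_self (AlonTarsi.conjugate L)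

theorem sum_isLatin_sign (n : ℕ) :
    ∑ L : Fin n → Fin n → Fin n with IsLatin L, sign L =
      Equiv.Perm.sign (Equiv.prodComm (Fin n) (Fin n)) *
        ∑ L : Fin n → Fin n → Fin n with IsLatin L, rowSign L := by
  rw [Finset.mul_sum]
  refine Finset.sum_nbij' conjugate (fun L => conjugate (conjugate L)) ?_ ?_ ?_ ?_ ?_
  all_goals intro L hL; replace hL : IsLatin L := by simpa using hL
  · simpa using hL.conjugate
  · simpa using hL.conjugate.conjugate
  · exact hL.conjugate_conjugate_conjugate
  · exact hL.conjugate_conjugate_conjugate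
  · exact hL.sign_eq

theorem evenCard_sub_oddCard (n : ℕ) :
    (evenCard n : ℤ) - oddCard n = ∑ L : Fin n → Fin n → Fin n with IsLatin L, sign L := by
  simp only [evenCard, oddCard, Finset.card_filter, Nat.cast_sum, Finset.sum_filter,
    ← Finset.sum_sub_distrib]
  refine Finset.sum_congr rfl fun L _ => ?_
  by_cases hL : IsLatin L
  · have h : sign L * sign L = 1 := by
      rw [sign]
      linear_combination colSign L * colSign L * rowSign_mul_self L + colSign_mul_self L
    rcases mul_self_eq_one_iff.1 h with h | h <;> simp [hL, h]
  · simp [hL]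

theorem evenCard_ne_oddCard_iff (n : ℕ) :
    evenCard n ≠ oddCard n ↔ ∑ L : Fin n → Fin n → Fin n with IsLatin L, rowSign L ≠ 0 := by
  rw [← Int.natCast_inj.ne, ← sub_ne_zero, evenCard_sub_oddCard, sum_isLatin_sign,
    mul_ne_zero_iff_left (Units.ne_zero _)]

theorem coeff_prod_X {R α β : Type*} [CommRing R] [Fintype α] [Fintype β] (f : α → β → β)
    [Decidable (∀ a, Function.Bijective (f a))] :
    coeff (∑ v, Finsupp.single v 1) (∏ a, ∏ b, (X (a, f a b) : MvPolynomial (α × β) R)) =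
      if ∀ a, Function.Bijective (f a) then 1 else 0 := by
  simp only [X, ← monomial_sum_one, coeff_monomial]
  refine if_congr ?_ rfl rfl
  have key : ∀ a c, (∑ a, ∑ b, Finsupp.single (a, f a b) 1 : α × β →₀ ℕ) (a, c) =
      (Finset.univ.filter fun b => f a b = c).card := by
    intro a c
    simp only [Finsupp.finsetSum_apply, Finsupp.single_apply, Prod.mk.injEq, Finset.card_filter]
    rw [Finset.sum_eq_single a (by simp +contextual) (by simp)]
    simp
  have hone : ∀ v, (∑ v, Finsupp.single v 1 : α × β →₀ ℕ) v = 1 := by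
    simp [Finsupp.finsetSum_apply, Finsupp.single_apply]
  simp only [Finsupp.ext_iff, Prod.forall, hone, key, Finset.card_eq_one_iff_existsUnique,
    Function.bijective_iff_existsUnique, Finset.mem_filter, Finset.mem_univ, true_and]

/-- Families of permutations are the functions of two variables with bijective rows. -/
theorem sum_pi_perm {M : Type*} [AddCommMonoid M] {α β : Type*} [Fintype α] [Fintype β]
    [DecidableEq α] [DecidableEq β] [DecidablePred fun f : α → β → β => ∀ a, Function.Bijective (f a)]
    (g : (α → β → β) → M) :
    ∑ σ : α → Equiv.Perm β, g (fun a b => σ a b) =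
      ∑ f : α → β → β with ∀ a, Function.Bijective (f a), g f := by
  refine Finset.sum_bij (fun σ _ a b => σ a b) ?_ ?_ ?_ ?_
  · exact fun σ _ => by simp
  · exact fun σ _ τ _ h => funext fun a => Equiv.ext fun b => congrFun (congrFun h a) b
  · intro f hf
    have hf : ∀ a, Function.Bijective (f a) := by simpa using hf
    exact ⟨fun a => Equiv.ofBijective _ (hf a), Finset.mem_univ _, rfl⟩
  · exact fun _ _ => rfl

section DiffOp

variable {R σ : Type*} [CommRing R]

theorem pderiv_comm (i j : σ) (p : MvPolynomial σ R) :
    pderiv i (pderiv j p) = pderiv j (pderiv i p) := by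
  ext m
  simp only [coeff_pderiv, Finsupp.add_apply, add_right_comm m]
  rcases eq_or_ne i j with rfl | h
  · rfl
  · simp [h, h.symm]
    ring

/-- The algebra generated by the partial derivatives. -/
noncomputable abbrev pderivAlgebra (R σ : Type*) [CommRing R] :
    Subalgebra R (Module.End R (MvPolynomial σ R)) :=
  Algebra.adjoin R (Set.range fun i : σ => (pderiv i).toLinearMap)

instance : IsMulCommutative (pderivAlgebra R σ) := by
  apply Algebra.isMulCommutative_adjoin
  rintro _ ⟨i, rfl⟩ _ ⟨j, rfl⟩
  exact LinearMap.ext (pderiv_comm i j)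

open scoped IsMulCommutative in
/-- The constant-coefficient differential operator with a given symbol: `X i` acts as `∂/∂X i`. -/
noncomputable def diffOp : MvPolynomial σ R →ₐ[R] Module.End R (MvPolynomial σ R) :=
  (pderivAlgebra R σ).val.comp
    (aeval fun i => (⟨(pderiv i).toLinearMap, Algebra.subset_adjoin ⟨i, rfl⟩⟩ : pderivAlgebra R σ))

@[simp]
theorem diffOp_X (i : σ) :
    diffOp (X i : MvPolynomial σ R) = (pderiv i).toLinearMap := by
  simp [diffOp]

theorem diffOp_X_mul_apply (i : σ) (p g : MvPolynomial σ R) :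
    diffOp (X i * p) g = diffOp p (pderiv i g) := by
  rw [mul_comm, map_mul, diffOp_X]
  rfl

theorem constantCoeff_diffOp_prod_X (s : Finset σ) (g : MvPolynomial σ R) :
    constantCoeff (diffOp (∏ i ∈ s, X i) g) = coeff (∑ i ∈ s, Finsupp.single i 1) g := by
  induction s using Finset.induction_on generalizing g with
  | empty => simp [constantCoeff_eq]
  | insert a s ha ih =>
    rw [Finset.prod_insert ha, diffOp_X_mul_apply, ih, coeff_pderiv, Finset.sum_insert ha, add_comm]
    have h : (∑ i ∈ s, Finsupp.single i 1 : σ →₀ ℕ) a = 0 := by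
      rw [Finsupp.finsetSum_apply]
      exact Finset.sum_eq_zero fun i hi => Finsupp.single_eq_of_ne fun h => ha (h ▸ hi)
    simp [h]

theorem isHomogeneous_diffOp_prod_X {ι : Type*} (s : Finset ι) (f : ι → σ) {d : ℕ}
    {g : MvPolynomial σ R} (hg : g.IsHomogeneous d) :
    (diffOp (∏ i ∈ s, X (f i)) g).IsHomogeneous (d - s.card) := by
  induction s using Finset.induction_on generalizing g d with
  | empty => simpa using hg
  | insert a s ha ih =>
    rw [Finset.prod_insert ha, diffOp_X_mul_apply, Finset.card_insert_of_notMem ha, add_comm,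
      ← Nat.sub_sub]
    exact ih hg.pderiv

end DiffOp

section Substitution

variable {R m : Type*} [CommRing R] [Fintype m]

/-- The substitution `X ↦ X * T` in polynomials in the entries of a matrix. -/
noncomputable def substMul (T : Matrix m m R) :
    MvPolynomial (m × m) R →ₐ[R] MvPolynomial (m × m) R :=
  aeval fun v => ∑ k, C (T k v.2) * X (v.1, k)

theorem constantCoeff_substMul (T : Matrix m m R) (p : MvPolynomial (m × m) R) :
    constantCoeff (substMul T p) = constantCoeff p := by
  induction p using MvPolynomial.induction_on with
  | C a => simp [substMul]
  | add p q hp hq => simp [hp, hq]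
  | mul_X p v hp => simp [substMul]

theorem pderiv_substMul (T : Matrix m m R) (i k : m) (g : MvPolynomial (m × m) R) :
    pderiv (i, k) (substMul T g) = substMul T (∑ j, C (T k j) * pderiv (i, j) g) := by
  induction g using MvPolynomial.induction_on with
  | C a => simp [substMul]
  | add p q hp hq => simp [hp, hq, mul_add, Finset.sum_add_distrib]
  | mul_X p v hp =>
    obtain ⟨a, b⟩ := v
    have hX : pderiv (i, k) (substMul T (X (a, b))) = if i = a then C (T k b) else 0 := by
      simp only [substMul, aeval_X, map_sum, pderiv_C_mul, pderiv_X, Pi.single_apply, Prod.mk.injEq]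
      by_cases h : i = a
      · simp [h]
      · simp [h, Ne.symm h]
    rw [map_mul, pderiv_mul, hp, hX]
    simp only [pderiv_mul, pderiv_X, Pi.single_apply, Prod.mk.injEq, mul_add,
      Finset.sum_add_distrib, map_add]
    congr 1
    · rw [← map_mul, Finset.sum_mul]
      simp only [mul_assoc]
    · by_cases h : i = a
      · simp [h, substMul, mul_comm]
      · simp [h, Ne.symm h]

theorem diffOp_substMul (T : Matrix m m R) (p g : MvPolynomial (m × m) R) :
    diffOp p (substMul T g) = substMul T (diffOp (substMul T.transpose p) g) := by
  induction p using MvPolynomial.induction_on generalizing g with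
  | C a =>
    rw [← algebraMap_eq, AlgHom.commutes, AlgHom.commutes, AlgHom.commutes]
    simp [Module.algebraMap_end_apply]
  | add p q hp hq => simp [hp, hq]
  | mul_X p v hp =>
    rw [mul_comm, diffOp_X_mul_apply, pderiv_substMul, hp, map_mul, mul_comm, map_mul,
      Module.End.mul_apply]
    congr 3
    simp [substMul, ← smul_eq_C_mul]

theorem substMul_det (T : Matrix m m R) [DecidableEq m] :
    substMul T (Matrix.det (Matrix.of fun i j : m => X (i, j))) =
      C T.det * Matrix.det (Matrix.of fun i j : m => X (i, j)) := by
  have h : (substMul T).mapMatrix (Matrix.of fun i j : m => X (i, j)) =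
      Matrix.of (fun i j : m => (X (i, j) : MvPolynomial (m × m) R)) * C.mapMatrix T := by
    ext1 i j
    simp [substMul, Matrix.mul_apply, mul_comm]
  rw [AlgHom.map_det, h, Matrix.det_mul, ← RingHom.map_det, mul_comm]

end Substitution

theorem genericDetC_eq_sum (n : ℕ) :
    genericDetC n = ∑ σ : Equiv.Perm (Fin n),
      C ((Equiv.Perm.sign σ : ℤ) : ℂ) * ∏ i, X (i, σ i) := by
  rw [genericDetC, ← Matrix.det_transpose, Matrix.det_apply']
  simp

theorem coeff_genericDetC_pow (n : ℕ) :
    coeff (∑ v, Finsupp.single v 1) (genericDetC n ^ n) =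
      ((∑ L : Fin n → Fin n → Fin n with IsLatin L, rowSign L : ℤ) : ℂ) := by
  have h : genericDetC n ^ n = ∑ L : Fin n → Fin n → Fin n with ∀ k, Function.Bijective (L k),
      C ((rowSign L : ℤ) : ℂ) * ∏ i, ∏ k, X (i, L k i) := by
    rw [genericDetC_eq_sum, Fintype.sum_pow, ← sum_pi_perm fun L : Fin n → Fin n → Fin n =>
      C ((rowSign L : ℤ) : ℂ) * ∏ i, ∏ k, X (i, L k i)]
    refine Finset.sum_congr rfl fun σ _ => ?_
    rw [Finset.prod_mul_distrib, Finset.prod_comm, ← map_prod]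
    simp [rowSign, signFun_perm]
  rw [h, coeff_sum]
  simp only [coeff_C_mul, coeff_prod_X (fun i k => _), mul_ite, mul_one, mul_zero,
    ← Finset.sum_filter, Finset.filter_filter, Int.cast_sum]
  exact Finset.sum_congr (Finset.filter_congr fun L _ => Iff.rfl) fun _ _ => rfl

/-- The permanent of the generic `n × n` matrix. -/
noncomputable def genericPerm (n : ℕ) : MvPolynomial (Fin n × Fin n) ℂ :=
  ∑ σ : Equiv.Perm (Fin n), ∏ i, X (i, σ i)

theorem permDerivOp_eq_diffOp (n : ℕ) : permDerivOp n = diffOp (genericPerm n) := by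
  simp only [permDerivOp, genericPerm, map_sum, ← List.prod_ofFn, map_list_prod, List.map_ofFn,
    Function.comp_def, diffOp_X]

theorem genericPerm_pow_eq_sum (n : ℕ) :
    genericPerm n ^ n = ∑ F : Fin n → Fin n → Fin n with ∀ k, Function.Bijective (F k),
      ∏ k, ∏ i, X (i, F k i) := by
  rw [genericPerm, Fintype.sum_pow,
    ← sum_pi_perm fun F : Fin n → Fin n → Fin n => ∏ k, ∏ i, X (i, F k i)]

theorem substMul_prod_X {R : Type*} [CommRing R] {m : Type*} [Fintype m] [DecidableEq m]
    (T : Matrix m m R) :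
    substMul T.transpose (∏ v, X v) =
      ∑ F : m → m → m, C (∏ k, ∏ i, T k (F k i)) * ∏ k, ∏ i, X (i, F k i) := by
  simp only [substMul, map_prod, aeval_X, Matrix.transpose_apply, Fintype.prod_prod_type]
  rw [Finset.prod_comm]
  simp only [Finset.prod_univ_sum, Fintype.piFinset_univ, Finset.prod_mul_distrib]

theorem eval_genericDetC (n : ℕ) (x : Fin n × Fin n → ℂ) :
    eval x (genericDetC n) = (Matrix.of fun i j => x (i, j)).det := by
  rw [genericDetC, RingHom.map_det]
  congr 1
  ext i j
  simp

theorem constantCoeff_diffOp_substMul (n : ℕ) (T : Matrix (Fin n) (Fin n) ℂ)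
    (p : MvPolynomial (Fin n × Fin n) ℂ) :
    constantCoeff (diffOp (substMul T.transpose p) (genericDetC n ^ n)) =
      T.det ^ n * constantCoeff (diffOp p (genericDetC n ^ n)) := by
  rw [← constantCoeff_substMul T, ← diffOp_substMul, map_pow, genericDetC, substMul_det, mul_pow,
    ← map_pow, ← smul_eq_C_mul, map_smul, smul_eq_C_mul, map_mul, constantCoeff_C]

theorem constantCoeff_diffOp_genericPerm_pow (n : ℕ) :
    constantCoeff (diffOp (genericPerm n ^ n) (genericDetC n ^ n)) =
      coeff (∑ v, Finsupp.single v 1) (genericDetC n ^ n) ^ 2 := by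
  let a (F : Fin n → Fin n → Fin n) : ℂ :=
    constantCoeff (diffOp (∏ k, ∏ i, X (i, F k i)) (genericDetC n ^ n))
  have h : ∑ F : Fin n → Fin n → Fin n, C (a F) * ∏ k, ∏ i, X (k, F k i) =
      C (coeff (∑ v, Finsupp.single v 1) (genericDetC n ^ n)) * genericDetC n ^ n := by
    refine MvPolynomial.funext fun x => ?_
    have hx := constantCoeff_diffOp_substMul n (Matrix.of fun i j => x (i, j)) (∏ v, X v)
    rw [constantCoeff_diffOp_prod_X, substMul_prod_X, ← eval_genericDetC, mul_comm] at hx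
    simp only [← smul_eq_C_mul, map_sum, map_smul, LinearMap.sum_apply, LinearMap.smul_apply] at hx
    simp only [smul_eq_C_mul, map_mul, constantCoeff_C, Matrix.of_apply] at hx
    simp only [map_sum, map_mul, map_prod, eval_C, eval_X, map_pow, a, ← hx]
    exact Finset.sum_congr rfl fun F _ => mul_comm _ _
  have hc := congrArg (coeff (∑ v, Finsupp.single v 1)) h
  simp only [coeff_sum, coeff_C_mul, coeff_prod_X, mul_ite, mul_one, mul_zero,
    ← Finset.sum_filter] at hc
  rw [sq, ← hc, genericPerm_pow_eq_sum]
  simp only [map_sum, LinearMap.sum_apply, a]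

theorem isHomogeneous_genericDetC (n : ℕ) : (genericDetC n).IsHomogeneous n := by
  rw [genericDetC_eq_sum]
  refine IsHomogeneous.sum _ _ _ fun σ _ => ?_
  simpa only [Finset.sum_const, Finset.card_univ, Fintype.card_fin, smul_eq_mul, mul_one, zero_add]
    using (isHomogeneous_C _ _).mul
      (IsHomogeneous.prod Finset.univ _ (fun _ => 1) fun i _ => isHomogeneous_X ℂ (i, σ i))

theorem isHomogeneous_permDerivOp_pow (n k : ℕ) {d : ℕ} {g : MvPolynomial (Fin n × Fin n) ℂ}
    (hg : g.IsHomogeneous d) : ((permDerivOp n ^ k) g).IsHomogeneous (d - n * k) := by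
  induction k with
  | zero => simpa using hg
  | succ k ih =>
    rw [pow_succ', Module.End.mul_apply, Nat.mul_succ, ← Nat.sub_sub, permDerivOp_eq_diffOp,
      genericPerm, map_sum, LinearMap.sum_apply]
    rw [permDerivOp_eq_diffOp, genericPerm] at ih
    refine IsHomogeneous.sum _ _ _ fun σ _ => ?_
    simpa using isHomogeneous_diffOp_prod_X Finset.univ (fun i => (i, σ i)) ih

theorem permDerivOp_pow_genericDetC_pow (n : ℕ) :
    (permDerivOp n ^ n) (genericDetC n ^ n) =
      C (((∑ L : Fin n → Fin n → Fin n with IsLatin L, rowSign L : ℤ) : ℂ) ^ 2) := by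
  have h := isHomogeneous_permDerivOp_pow n n ((isHomogeneous_genericDetC n).pow n)
  rw [Nat.sub_self, ← totalDegree_zero_iff_isHomogeneous, totalDegree_eq_zero_iff_eq_C] at h
  rw [h, ← constantCoeff_eq, permDerivOp_eq_diffOp, ← map_pow, constantCoeff_diffOp_genericPerm_pow,
    coeff_genericDetC_pow]

/-- For n even, the Alon-Tarsi property for n holds iff D^n((det X)^n) ≠ 0. -/
theorem alonTarsi_iff_permDerivOp_pow_det_pow_ne_zero (n : ℕ) (hn : 0 < n) (hev : Even n) :
    evenCard n ≠ oddCard n ↔ (permDerivOp n ^ n) ((genericDetC n) ^ n) ≠ 0 := by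
  rw [evenCard_ne_oddCard_iff, permDerivOp_pow_genericDetC_pow, Ne, Ne, C_eq_zero,
    pow_eq_zero_iff two_ne_zero, Int.cast_eq_zero]

end AlonTarsi
end
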